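/- Let D be a strong digraph of order n = 2m+1 ≥ 3 that contains no cycle passing through all of its T-vertices, let C = x_1x_2…x_{n−1}x_1 be a cycle of length n−1 in D, and let x be the unique vertex of D not on C. Then at least two vertices of C are not adjacent to x, unless D is isomorphic to D_5 or to D_7 or belongs to the set L_1 ∪ L_2. -/

import Mathlib

/-!
Basic framework: finite loopless digraphs (arcs may exist in both directions),
degrees, adjacency, directed cycles (as injective maps from `ZMod k` respecting
arcs), strong and 2-strong connectivity, T-vertices, and the special digraphs
`D₅`, `D₇`, the classes `L₁`, `L₂`, etc. from the paper
"On Cycles through Vertices of Large Semidegree in Digraphs".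
-/

/-- A digraph: a loopless arc relation (arcs `u → v`; both `uv` and `vu` allowed). -/
structure Dgr (V : Type*) where
  Arc : V → V → Prop
  loopless : ∀ v, ¬ Arc v v

namespace Dgr

variable {V : Type*}

/-- Two vertices are adjacent if there is an arc between them in some direction. -/
def Adj (D : Dgr V) (u v : V) : Prop := D.Arc u v ∨ D.Arc v u

/-- Out-degree `d⁺(u)`. -/
noncomputable def outDeg (D : Dgr V) (u : V) : ℕ := {v | D.Arc u v}.ncard

/-- In-degree `d⁻(u)`. -/
noncomputable def inDeg (D : Dgr V) (u : V) : ℕ := {v | D.Arc v u}.ncard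

/-- Degree `d(u) = d⁺(u) + d⁻(u)`. -/
noncomputable def deg (D : Dgr V) (u : V) : ℕ := D.outDeg u + D.inDeg u

/-- `d⁺(u, A)`: number of out-neighbours of `u` in `A`. -/
noncomputable def outDegOn (D : Dgr V) (u : V) (A : Set V) : ℕ := {v ∈ A | D.Arc u v}.ncard

/-- `d⁻(u, A)`: number of in-neighbours of `u` in `A`. -/
noncomputable def inDegOn (D : Dgr V) (u : V) (A : Set V) : ℕ := {v ∈ A | D.Arc v u}.ncard

/-- `d(u, A) = d⁺(u, A) + d⁻(u, A)`. -/
noncomputable def degOn (D : Dgr V) (u : V) (A : Set V) : ℕ := D.outDegOn u A + D.inDegOn u A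

/-- In a digraph of order `2m+1`, a `T`-vertex is one with `d⁺(u) ≥ m` and `d⁻(u) ≥ m`. -/
def TVertex (D : Dgr V) (m : ℕ) (u : V) : Prop := m ≤ D.outDeg u ∧ m ≤ D.inDeg u

/-- A directed cycle of length `k ≥ 2`, given as an injective map `c : ZMod k → V`
with an arc from each `c i` to `c (i+1)`. -/
def IsCycle (D : Dgr V) {k : ℕ} (c : ZMod k → V) : Prop :=
  2 ≤ k ∧ Function.Injective c ∧ ∀ i, D.Arc (c i) (c (i + 1))

/-- `D` has a (directed) cycle through all vertices of `S`. -/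
def CycleThrough (D : Dgr V) (S : Set V) : Prop :=
  ∃ (k : ℕ) (c : ZMod k → V), D.IsCycle c ∧ S ⊆ Set.range c

/-- A Hamiltonian cycle: a cycle through all the vertices. -/
def Hamiltonian (D : Dgr V) [Fintype V] : Prop :=
  ∃ c : ZMod (Fintype.card V) → V, D.IsCycle c ∧ Function.Surjective c

/-- `D` is strong: a directed path (walk) from `u` to `v` for every pair of
distinct vertices. -/
def Strong (D : Dgr V) : Prop :=
  ∀ u v : V, u ≠ v → Relation.TransGen D.Arc u v

/-- The induced subdigraph on a set `S` of vertices. -/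
def restrict (D : Dgr V) (S : Set V) : Dgr S where
  Arc a b := D.Arc a b
  loopless v := D.loopless v

/-- `D` is 2-strong: at least 3 vertices, and deleting any single vertex leaves
a strong digraph. -/
def TwoStrong (D : Dgr V) [Fintype V] : Prop :=
  3 ≤ Fintype.card V ∧ ∀ w : V, (D.restrict {v | v ≠ w}).Strong

/-- Isomorphism of digraphs. -/
def Iso (D : Dgr V) {W : Type*} (E : Dgr W) : Prop :=
  ∃ e : V ≃ W, ∀ a b : V, D.Arc a b ↔ E.Arc (e a) (e b)

end Dgr

/-- A digraph defined by a list of arcs. -/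
def ofList {V : Type*} [DecidableEq V] (l : List (V × V)) (h : ∀ v : V, (v, v) ∉ l) :
    Dgr V where
  Arc a b := (a, b) ∈ l
  loopless v hv := h v hv

/-- Arcs of the digraph `D₅` (vertices `x₁,x₂,x₃ = 0,1,2`, `x = 3`, `y = 4`):
`N⁺(x₁)={x₂,y}`, `N⁺(x₂)={x₃,x}`, `N⁺(x₃)={x,y}`, `N⁺(x)={x₁,x₂}`, `N⁺(y)={x₁,x₃}`. -/
def D5arcs : List (Fin 5 × Fin 5) :=
  [(0,1),(0,4),(1,2),(1,3),(2,3),(2,4),(3,0),(3,1),(4,0),(4,2)]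

/-- The digraph `D₅`. -/
def D5 : Dgr (Fin 5) := ofList D5arcs (by decide)

/-- `L₁`: the three digraphs obtained from `D₅` by adding the arc `x₁x₃`, the arc
`x₃x₁`, or both. -/
def L1 : Set (Dgr (Fin 5)) :=
  {ofList ((0,2) :: D5arcs) (by decide),
   ofList ((2,0) :: D5arcs) (by decide),
   ofList ((0,2) :: (2,0) :: D5arcs) (by decide)}

/-- Arcs of the digraph `D₇` (vertices `x₁,…,x₅ = 0,…,4`, `x = 5`, `y = 6`):
`N⁺(x₁)={x₂,x₅,y}`, `N⁺(x₂)={x₃,x₄,y}`, `N⁺(x₃)={x₂,x₄,x}`, `N⁺(x₄)={x₃,x₅,x}`,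
`N⁺(x₅)={x₁,x,y}`, `N⁺(x)={x₁,x₂,x₃}`, `N⁺(y)={x₁,x₄,x₅}`. -/
def D7arcs : List (Fin 7 × Fin 7) :=
  [(0,1),(0,4),(0,6),(1,2),(1,3),(1,6),(2,1),(2,3),(2,5),(3,2),(3,4),(3,5),
   (4,0),(4,5),(4,6),(5,0),(5,1),(5,2),(6,0),(6,3),(6,4)]

/-- The digraph `D₇`. -/
def D7 : Dgr (Fin 7) := ofList D7arcs (by decide)

/-- Membership in the class `L₂`: there is an enumeration `x_1,…,x_{2m}, x` of the
vertices (here `b i = x_i`, indices mod `2m`, so `b 0 = x_{2m}`) such that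
`x_1x_2⋯x_{2m}x_1` is a cycle, `x` and `x_{2m}` are nonadjacent,
`N⁺(x) = N⁺(x_{2m}) = {x_1,…,x_m}`, `N⁻(x) = N⁻(x_{2m}) = {x_m,…,x_{2m-1}}`,
and there is no arc from `{x_1,…,x_{m-1}}` to `{x_{m+1},…,x_{2m-1}}`. -/
def InL2 {V : Type*} (D : Dgr V) (m : ℕ) : Prop :=
  ∃ (b : ZMod (2 * m) → V) (x : V),
    1 ≤ m ∧
    Function.Injective b ∧ x ∉ Set.range b ∧
    (∀ i, D.Arc (b i) (b (i + 1))) ∧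
    ¬ D.Adj x (b 0) ∧
    {v | D.Arc x v} = (fun i : ℕ => b i) '' Set.Icc 1 m ∧
    {v | D.Arc (b 0) v} = (fun i : ℕ => b i) '' Set.Icc 1 m ∧
    {v | D.Arc v x} = (fun i : ℕ => b i) '' Set.Icc m (2 * m - 1) ∧
    {v | D.Arc v (b 0)} = (fun i : ℕ => b i) '' Set.Icc m (2 * m - 1) ∧
    (∀ i ∈ Set.Icc 1 (m - 1), ∀ j ∈ Set.Icc (m + 1) (2 * m - 1),
      ¬ D.Arc (b (i : ℕ)) (b (j : ℕ)))

/-- `K*_{m,m+1} ⊆ D ⊆ [K_m + K̄_{m+1}]*` (containments as spanning subdigraphs):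
the vertex set splits into `A` of size `m` and its complement of size `m+1`, all arcs
between `A` and `Aᶜ` are present in both directions, and there are no arcs inside `Aᶜ`. -/
def KSandwich {V : Type*} (D : Dgr V) (m : ℕ) : Prop :=
  ∃ A : Set V, A.ncard = m ∧ Aᶜ.ncard = m + 1 ∧
    (∀ a ∈ A, ∀ b ∈ Aᶜ, D.Arc a b ∧ D.Arc b a) ∧
    (∀ u ∈ Aᶜ, ∀ v ∈ Aᶜ, ¬ D.Arc u v)

/-- Alternative (iv) of Theorem 2: `D` has a cycle `C = z_1 z_2 ⋯ z_{2m} z_1` of length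
`2m` such that, with `z` the vertex off the cycle, at least `3` vertices of the cycle
are nonadjacent to `z`, and every cycle vertex `z_l` nonadjacent to `z` satisfies
`z_{l-1}z, z z_{l+1} ∈ A(D)`, `N⁺(z) = N⁺(z_l)` and `N⁻(z) = N⁻(z_l)`; in particular
these vertices together with `z` form an independent set. -/
def PropIV {V : Type*} (D : Dgr V) (m : ℕ) : Prop :=
  ∃ (c : ZMod (2 * m) → V) (z : V),
    D.IsCycle c ∧ z ∉ Set.range c ∧
    3 ≤ {i : ZMod (2 * m) | ¬ D.Adj z (c i)}.ncard ∧
    (∀ i : ZMod (2 * m), ¬ D.Adj z (c i) →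
      D.Arc (c (i - 1)) z ∧ D.Arc z (c (i + 1)) ∧
      {v | D.Arc z v} = {v | D.Arc (c i) v} ∧
      {v | D.Arc v z} = {v | D.Arc v (c i)}) ∧
    (insert z (c '' {i | ¬ D.Adj z (c i)})).Pairwise (fun a b => ¬ D.Adj a b)

/-! ## Label world: arcs between labels `0, …, 2m` -/

namespace Lab

/-- A simple path from `u` to `v` with vertex set `S`. -/
inductive Path (A : ℕ → ℕ → Prop) : ℕ → ℕ → Set ℕ → Prop
  | single (u : ℕ) : Path A u u {u}
  | cons (u v w : ℕ) (S : Set ℕ) : A u v → u ∉ S → Path A v w S → Path A u w (insert u S)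

variable {A : ℕ → ℕ → Prop}

theorem Path.append {u v u' v' : ℕ} {S S' : Set ℕ} (h : Path A u v S) (ha : A v u')
    (h' : Path A u' v' S') (hd : ∀ j, j ∈ S → j ∉ S') : Path A u v' (S ∪ S') := by
  induction h with
  | single u =>
    have := Path.cons u u' v' S' ha (hd u rfl) h'
    rwa [Set.insert_eq] at this
  | cons u v w S h1 h2 h3 ih =>
    have h4 := ih ha (fun j hj => hd j (Set.mem_insert_of_mem _ hj))
    have := Path.cons u v v' (S ∪ S') h1
      (by
        intro h5
        rcases h5 with h5 | h5
        · exact h2 h5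
        · exact hd u (Set.mem_insert _ _) h5) h4
    rwa [← Set.insert_union] at this

theorem Path.mapSeg (e : ℕ → ℕ) (N : ℕ) (hinj : ∀ i < N, ∀ j < N, e i = e j → i = j)
    (harc : ∀ i, i + 1 < N → A (e i) (e (i + 1))) (s d : ℕ) (h : s + d < N) :
    Path A (e s) (e (s + d)) (e '' Set.Icc s (s + d)) := by
  induction d generalizing s with
  | zero => simpa using Path.single (e s)
  | succ d ih =>
    have h1 := ih (s + 1) (by omega)
    have h2 := Path.cons (e s) (e (s + 1)) _ _ (harc s (by omega))
      (by
        rintro ⟨j, hj, hje⟩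
        simp only [Set.mem_Icc] at hj
        have := hinj j (by omega) s (by omega) hje
        omega) h1
    rw [show s + (d + 1) = s + 1 + d by ring]
    convert h2 using 1
    rw [← Set.image_insert_eq]
    congr 1
    ext j
    simp only [Set.mem_Icc, Set.mem_insert_iff]
    omega

open Classical in
/-- out-degree in label world -/
noncomputable def outC (A : ℕ → ℕ → Prop) (m w : ℕ) : ℕ :=
  ((Finset.range (2 * m + 1)).filter (fun j => A w j)).card

open Classical in
/-- in-degree in label world -/
noncomputable def inC (A : ℕ → ℕ → Prop) (m w : ℕ) : ℕ :=
  ((Finset.range (2 * m + 1)).filter (fun j => A j w)).card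

/-- Hypotheses in label world. -/
structure Hyp (m : ℕ) (A : ℕ → ℕ → Prop) : Prop where
  pos : 1 ≤ m
  loop : ∀ i, ¬ A i i
  ham : ∀ u v S, Path A u v S → A v u → (∀ j, j ∈ S ↔ j ≤ 2 * m) → False
  off : ∀ w u v S, w ≤ 2 * m → Path A u v S → A v u →
    (∀ j, j ∈ S ↔ j ≤ 2 * m ∧ j ≠ w) → m ≤ outC A m w ∧ m ≤ inC A m w
  arc : ∀ i, i + 1 < 2 * m → A i (i + 1)
  close : A (2 * m - 1) 0
  adj : ∀ i, 1 ≤ i → i < 2 * m → A (2 * m) i ∨ A i (2 * m)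

/-- A cycle of length `2m` missing the label `w`. -/
structure Cyc (m : ℕ) (A : ℕ → ℕ → Prop) (e : ℕ → ℕ) (w : ℕ) : Prop where
  inj : ∀ i < 2 * m, ∀ j < 2 * m, e i = e j → i = j
  le : ∀ i < 2 * m, e i ≤ 2 * m
  wle : w ≤ 2 * m
  ne : ∀ i < 2 * m, e i ≠ w
  surj : ∀ j ≤ 2 * m, j ≠ w → ∃ i < 2 * m, e i = j
  arc : ∀ i, i + 1 < 2 * m → A (e i) (e (i + 1))
  close : A (e (2 * m - 1)) (e 0)

/-- cyclic successor -/
def sc (N i : ℕ) : ℕ := if i + 1 = N then 0 else i + 1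

theorem Cyc.notboth {m : ℕ} {e : ℕ → ℕ} {w : ℕ} (H : Hyp m A) (C : Cyc m A e w) (i : ℕ)
    (hi : i < 2 * m) (h1 : A (e i) w) (h2 : A w (e (sc (2 * m) i))) : False := by
  have hm := H.pos
  have p1 : Path A (e 0) (e i) (e '' Set.Icc 0 i) := by
    simpa using Path.mapSeg e (2 * m) C.inj C.arc 0 i (by omega)
  have p2 : Path A (e 0) w (e '' Set.Icc 0 i ∪ {w}) :=
    p1.append h1 (Path.single w) (by
      rintro j ⟨k, hk, rfl⟩ h
      simp only [Set.mem_Icc] at hk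
      exact C.ne k (by omega) h)
  unfold sc at h2
  split_ifs at h2 with h3
  · refine H.ham _ _ _ p2 h2 ?_
    intro j
    constructor
    · rintro (⟨k, hk, rfl⟩ | rfl)
      · simp only [Set.mem_Icc] at hk
        exact C.le k (by omega)
      · exact C.wle
    · intro hj
      by_cases hjw : j = w
      · right; exact hjw
      · obtain ⟨k, hk, rfl⟩ := C.surj j hj hjw
        left
        exact ⟨k, by simp only [Set.mem_Icc]; omega, rfl⟩
  · have p3 : Path A (e (i + 1)) (e (2 * m - 1)) (e '' Set.Icc (i + 1) (2 * m - 1)) := by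
      have := Path.mapSeg e (2 * m) C.inj C.arc (i + 1) (2 * m - 1 - (i + 1)) (by omega)
      rwa [show i + 1 + (2 * m - 1 - (i + 1)) = 2 * m - 1 by omega] at this
    have p4 := p2.append h2 p3 (by
      rintro j (⟨k, hk, rfl⟩ | h) ⟨l, hl, hle⟩
      · simp only [Set.mem_Icc] at hk hl
        have := C.inj l (by omega) k (by omega) hle
        omega
      · simp only [Set.mem_Icc] at hl
        exact C.ne l (by omega) (hle.trans h))
    refine H.ham _ _ _ p4 C.close ?_
    intro j
    constructor
    · rintro ((⟨k, hk, rfl⟩ | rfl) | ⟨k, hk, rfl⟩)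
      · simp only [Set.mem_Icc] at hk
        exact C.le k (by omega)
      · exact C.wle
      · simp only [Set.mem_Icc] at hk
        exact C.le k (by omega)
    · intro hj
      by_cases hjw : j = w
      · left; right; exact hjw
      · obtain ⟨k, hk, rfl⟩ := C.surj j hj hjw
        by_cases hki : k ≤ i
        · left; left
          exact ⟨k, by simp only [Set.mem_Icc]; omega, rfl⟩
        · right
          exact ⟨k, by simp only [Set.mem_Icc]; omega, rfl⟩

theorem Cyc.offT {m : ℕ} {e : ℕ → ℕ} {w : ℕ} (H : Hyp m A) (C : Cyc m A e w) :
    m ≤ outC A m w ∧ m ≤ inC A m w := by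
  have hm := H.pos
  have p1 : Path A (e 0) (e (2 * m - 1)) (e '' Set.Icc 0 (2 * m - 1)) := by
    simpa using Path.mapSeg e (2 * m) C.inj C.arc 0 (2 * m - 1) (by omega)
  refine H.off w _ _ _ C.wle p1 C.close ?_
  intro j
  constructor
  · rintro ⟨k, hk, rfl⟩
    simp only [Set.mem_Icc] at hk
    exact ⟨C.le k (by omega), C.ne k (by omega)⟩
  · rintro ⟨h1, h2⟩
    obtain ⟨k, hk, rfl⟩ := C.surj j h1 h2
    exact ⟨k, by simp only [Set.mem_Icc]; omega, rfl⟩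

open Classical in
theorem Cyc.rule {m : ℕ} {e : ℕ → ℕ} {w : ℕ} (H : Hyp m A) (C : Cyc m A e w) :
    outC A m w = m ∧ inC A m w = m ∧
      ∀ i < 2 * m, (A (e i) w ↔ ¬ A w (e (sc (2 * m) i))) := by
  have hm := H.pos
  obtain ⟨ho, hi⟩ := C.offT H
  have scl : ∀ i < 2 * m, sc (2 * m) i < 2 * m := by
    intro i hi
    unfold sc
    split_ifs <;> omega
  set P := (Finset.range (2 * m)).filter (fun i => A (e i) w) with hP
  set Q := (Finset.range (2 * m)).filter (fun i => A w (e (sc (2 * m) i))) with hQ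
  have hPc : inC A m w = P.card := by
    unfold inC
    symm
    refine Finset.card_bij (fun i _ => e i) ?_ ?_ ?_
    · intro i hi
      simp only [hP, Finset.mem_filter, Finset.mem_range] at hi ⊢
      exact ⟨by have := C.le i hi.1; omega, hi.2⟩
    · intro i hi j hj h
      simp only [hP, Finset.mem_filter, Finset.mem_range] at hi hj
      exact C.inj i hi.1 j hj.1 h
    · intro j hj
      simp only [Finset.mem_filter, Finset.mem_range] at hj
      obtain ⟨k, hk, rfl⟩ := C.surj j (by omega) (by
        rintro rfl
        exact H.loop _ hj.2)
      exact ⟨k, by simp only [hP, Finset.mem_filter, Finset.mem_range]; exact ⟨hk, hj.2⟩, rfl⟩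
  have hQc : outC A m w = Q.card := by
    unfold outC
    symm
    refine Finset.card_bij (fun i _ => e (sc (2 * m) i)) ?_ ?_ ?_
    · intro i hi
      simp only [hQ, Finset.mem_filter, Finset.mem_range] at hi ⊢
      exact ⟨by have := C.le _ (scl i hi.1); omega, hi.2⟩
    · intro i hi j hj h
      simp only [hQ, Finset.mem_filter, Finset.mem_range] at hi hj
      have := C.inj _ (scl i hi.1) _ (scl j hj.1) h
      unfold sc at this
      split_ifs at this <;> omega
    · intro j hj
      simp only [Finset.mem_filter, Finset.mem_range] at hj
      obtain ⟨k, hk, rfl⟩ := C.surj j (by omega) (by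
        rintro rfl
        exact H.loop _ hj.2)
      have : ∃ i < 2 * m, sc (2 * m) i = k := by
        by_cases h0 : k = 0
        · refine ⟨2 * m - 1, by omega, ?_⟩
          unfold sc
          split_ifs <;> omega
        · refine ⟨k - 1, by omega, ?_⟩
          unfold sc
          split_ifs <;> omega
      obtain ⟨i, hi, rfl⟩ := this
      exact ⟨i, by simp only [hQ, Finset.mem_filter, Finset.mem_range]; exact ⟨hi, hj.2⟩, rfl⟩
  have hd : Disjoint P Q := by
    rw [Finset.disjoint_left]
    intro i hi hj
    simp only [hP, hQ, Finset.mem_filter, Finset.mem_range] at hi hj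
    exact C.notboth H i hi.1 hi.2 hj.2
  have hsub : P ∪ Q ⊆ Finset.range (2 * m) := by
    intro i hi
    simp only [hP, hQ, Finset.mem_union, Finset.mem_filter] at hi
    tauto
  have hcu := Finset.card_union_of_disjoint hd
  have hle := Finset.card_le_card hsub
  rw [Finset.card_range] at hle
  have heq : P ∪ Q = Finset.range (2 * m) :=
    Finset.eq_of_subset_of_card_le hsub (by rw [Finset.card_range]; omega)
  refine ⟨by omega, by omega, ?_⟩
  intro i hi
  constructor
  · intro h1 h2
    exact C.notboth H i hi h1 h2
  · intro h
    have : i ∈ P ∪ Q := by rw [heq]; simpa using hi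
    simp only [hP, hQ, Finset.mem_union, Finset.mem_filter] at this
    tauto

theorem Cyc.replace {m : ℕ} {e : ℕ → ℕ} {w : ℕ} (H : Hyp m A) (C : Cyc m A e w) (k : ℕ)
    (hk : k < 2 * m) (h1 : ¬ A (e k) w) (h2 : ¬ A w (e k)) :
    Cyc m A (Function.update e k w) (e k) := by
  have hm := H.pos
  obtain ⟨-, -, hr⟩ := C.rule H
  have key : ∀ i < 2 * m, A (Function.update e k w i) (Function.update e k w (sc (2 * m) i)) := by
    intro i hi
    have hri := hr i hi
    have hsc : sc (2 * m) i ≠ i := by unfold sc; split_ifs <;> omega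
    by_cases hik : i = k
    · subst hik
      rw [Function.update_self, Function.update_of_ne hsc]
      tauto
    · rw [Function.update_of_ne hik]
      by_cases hsk : sc (2 * m) i = k
      · rw [hsk, Function.update_self]
        rw [hsk] at hri
        tauto
      · rw [Function.update_of_ne hsk]
        unfold sc
        split_ifs with h3
        · have := C.close
          rwa [show 2 * m - 1 = i by omega] at this
        · exact C.arc i (by omega)
  refine ⟨?_, ?_, C.le k hk, ?_, ?_, ?_, ?_⟩
  · intro i hi j hj h
    simp only [Function.update_apply] at h
    split_ifs at h with ha hb hb
    · omega
    · exact absurd h.symm (C.ne j hj)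
    · exact absurd h (C.ne i hi)
    · exact C.inj i hi j hj h
  · intro i hi
    rw [Function.update_apply]
    split_ifs
    · exact C.wle
    · exact C.le i hi
  · intro i hi
    rw [Function.update_apply]
    split_ifs with h
    · exact (C.ne k hk).symm
    · exact fun h' => h (C.inj i hi k hk h')
  · intro j hj hjk
    by_cases hjw : j = w
    · exact ⟨k, hk, by rw [Function.update_self, hjw]⟩
    · obtain ⟨i, hi, rfl⟩ := C.surj j hj hjw
      exact ⟨i, hi, Function.update_of_ne (fun h => hjk (by rw [h])) _ _⟩
  · intro i hi
    have := key i (by omega)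
    rwa [show sc (2 * m) i = i + 1 by unfold sc; split_ifs <;> omega] at this
  · have := key (2 * m - 1) (by omega)
    rwa [show sc (2 * m) (2 * m - 1) = 0 by unfold sc; split_ifs <;> omega] at this

theorem sc_last {m : ℕ} (hm : 1 ≤ m) : sc (2 * m) (2 * m - 1) = 0 := by
  unfold sc
  split_ifs <;> omega

theorem sc_lt {m i : ℕ} (h : i + 1 < 2 * m) : sc (2 * m) i = i + 1 := by
  unfold sc
  split_ifs <;> omega

theorem cyc0 {m : ℕ} (H : Hyp m A) : Cyc m A (fun i => i) (2 * m) := by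
  have hm := H.pos
  refine ⟨fun i _ j _ h => h, fun i hi => ?_, le_refl _, fun i hi => ?_, fun j hj hne => ?_,
    H.arc, H.close⟩
  · show i ≤ _
    omega
  · show i ≠ _
    omega
  · exact ⟨j, by omega, rfl⟩

theorem Hyp.seg {m : ℕ} (H : Hyp m A) (s t : ℕ) (hst : s ≤ t) (ht : t < 2 * m) :
    Path A s t (Set.Icc s t) := by
  have := Path.mapSeg (fun i => i) (2 * m) (fun i _ j _ h => h) H.arc s (t - s) (by omega)
  simpa [show s + (t - s) = t by omega] using this

theorem out_le {m w c : ℕ} (F : Finset ℕ) (hF : F.card ≤ c)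
    (h : ∀ j ≤ 2 * m, A w j → j ∈ F) : outC A m w ≤ c := by
  classical
  refine le_trans (Finset.card_le_card ?_) hF
  intro j hj
  simp only [Finset.mem_filter, Finset.mem_range] at hj
  exact h j (by omega) hj.2

theorem in_le {m w c : ℕ} (F : Finset ℕ) (hF : F.card ≤ c)
    (h : ∀ j ≤ 2 * m, A j w → j ∈ F) : inC A m w ≤ c := by
  classical
  refine le_trans (Finset.card_le_card ?_) hF
  intro j hj
  simp only [Finset.mem_filter, Finset.mem_range] at hj
  exact h j (by omega) hj.2

theorem le_out {m w c : ℕ} (F : Finset ℕ) (hF : c ≤ F.card)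
    (h : ∀ j ∈ F, j ≤ 2 * m ∧ A w j) : c ≤ outC A m w := by
  classical
  refine le_trans hF (Finset.card_le_card ?_)
  intro j hj
  simp only [Finset.mem_filter, Finset.mem_range]
  exact ⟨by have := (h j hj).1; omega, (h j hj).2⟩

theorem le_in {m w c : ℕ} (F : Finset ℕ) (hF : c ≤ F.card)
    (h : ∀ j ∈ F, j ≤ 2 * m ∧ A j w) : c ≤ inC A m w := by
  classical
  refine le_trans hF (Finset.card_le_card ?_)
  intro j hj
  simp only [Finset.mem_filter, Finset.mem_range]
  exact ⟨by have := (h j hj).1; omega, (h j hj).2⟩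

theorem Hyp.sg {m : ℕ} (H : Hyp m A) (s t : ℕ) (hst : s ≤ t) (ht : t < 2 * m ∨ s = t) :
    Path A s t (Set.Icc s t) := by
  rcases ht with ht | rfl
  · exact H.seg s t hst ht
  · simpa using Path.single s

theorem thr {m w : ℕ} (hm : 1 ≤ m)
    (hr : ∀ i, 1 ≤ i → i + 1 < 2 * m → (A i w ↔ ¬ A w (i + 1)))
    (hadj : ∀ i, 1 ≤ i → i < 2 * m → A w i ∨ A i w) (h1 : A w 1) (hin : inC A m w = m)
    (hno : ∀ j ≤ 2 * m, A j w → 1 ≤ j ∧ j < 2 * m) :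
    ∀ i, 1 ≤ i → i < 2 * m → ((A i w ↔ m ≤ i) ∧ (A w i ↔ i ≤ m)) := by
  have up1 : ∀ i, 1 ≤ i → i + 1 < 2 * m → A i w → A (i + 1) w := by
    intro i hi hi' h
    have := hr i hi hi'
    have := hadj (i + 1) (by omega) hi'
    tauto
  have up : ∀ d i, 1 ≤ i → i + d < 2 * m → A i w → A (i + d) w := by
    intro d
    induction d with
    | zero => intro i _ _ h; exact h
    | succ d ih =>
      intro i hi hi' h
      exact up1 (i + d) (by omega) (by omega) (ih i hi (by omega) h)
  have main : ∀ i, 1 ≤ i → i < 2 * m → (A i w ↔ m ≤ i) := by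
    intro i hi hi'
    constructor
    · intro h
      by_contra hlt
      have : m + 1 ≤ inC A m w := le_in (Finset.Icc i (2 * m - 1))
        (by rw [Nat.card_Icc]; omega) (by
          intro j hj
          simp only [Finset.mem_Icc] at hj
          refine ⟨by omega, ?_⟩
          have := up (j - i) i hi (by omega) h
          rwa [show i + (j - i) = j by omega] at this)
      omega
    · intro h
      by_contra hn
      have : inC A m w ≤ m - 1 := in_le (Finset.Icc (i + 1) (2 * m - 1))
        (by rw [Nat.card_Icc]; omega) (by
          intro j hj hjw
          simp only [Finset.mem_Icc]
          have := hno j hj hjw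
          refine ⟨?_, by omega⟩
          by_contra hlt
          have := up (i - j) j (by omega) (by omega) hjw
          rw [show j + (i - j) = i by omega] at this
          exact hn this)
      omega
  intro i hi hi'
  refine ⟨main i hi hi', ?_⟩
  by_cases h : i = 1
  · subst h
    exact ⟨fun _ => hm, fun _ => h1⟩
  · have h2 := hr (i - 1) (by omega) (by omega)
    have h3 := main (i - 1) (by omega) (by omega)
    rw [show i - 1 + 1 = i by omega] at h2
    constructor
    · intro h4
      by_contra h5
      exact (h2.1 (h3.2 (by omega))) h4
    · intro h4
      by_contra h5
      have := h3.1 (h2.2 h5)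
      omega

/-- Facts on `x` (label `2m`) and `y` (label `0`). -/
structure Base (m : ℕ) (A : ℕ → ℕ → Prop) : Prop where
  n0X : ¬ A 0 (2 * m)
  nX0 : ¬ A (2 * m) 0
  inX : ∀ i, 1 ≤ i → i < 2 * m → (A i (2 * m) ↔ m ≤ i)
  outX : ∀ i, 1 ≤ i → i < 2 * m → (A (2 * m) i ↔ i ≤ m)
  ry : ∀ i, 1 ≤ i → i + 1 < 2 * m → (A i 0 ↔ ¬ A 0 (i + 1))
  out0 : outC A m 0 = m
  in0 : inC A m 0 = m
  a01 : A 0 1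
  cyc : Cyc m A (Function.update (fun i => i) 0 (2 * m)) 0

theorem Hyp.base {m : ℕ} (H : Hyp m A) : Base m A := by
  have hm := H.pos
  obtain ⟨ho, hi, hr⟩ := (cyc0 H).rule H
  have hr1 : ∀ i, i + 1 < 2 * m → (A i (2 * m) ↔ ¬ A (2 * m) (i + 1)) := by
    intro i hi
    have := hr i (by omega)
    rwa [sc_lt hi] at this
  have hr2 : A (2 * m - 1) (2 * m) ↔ ¬ A (2 * m) 0 := by
    have := hr (2 * m - 1) (by omega)
    rwa [sc_last hm] at this
  have n0X : ¬ A 0 (2 * m) := by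
    intro h
    have all : ∀ i, i < 2 * m → A i (2 * m) := by
      intro i
      induction i with
      | zero => intro _; exact h
      | succ i ih =>
        intro hi
        have h1 := ih (by omega)
        have h2 := hr1 i hi
        have h3 := H.adj (i + 1) (by omega) hi
        tauto
    have : m + 1 ≤ inC A m (2 * m) := le_in (Finset.range (2 * m))
      (by rw [Finset.card_range]; omega) (by
        intro j hj
        rw [Finset.mem_range] at hj
        exact ⟨by omega, all j hj⟩)
    omega
  have nX0 : ¬ A (2 * m) 0 := by
    intro h
    have all : ∀ d, d < 2 * m → ¬ A (2 * m - 1 - d) (2 * m) := by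
      intro d
      induction d with
      | zero => intro _; simp only [Nat.sub_zero]; tauto
      | succ d ih =>
        intro hd
        have h1 := ih (by omega)
        have h2 := hr1 (2 * m - 1 - (d + 1)) (by omega)
        rw [show 2 * m - 1 - (d + 1) + 1 = 2 * m - 1 - d by omega] at h2
        have h3 := H.adj (2 * m - 1 - d) (by omega) (by omega)
        tauto
    have : inC A m (2 * m) ≤ 0 := in_le ∅ (by simp) (by
        intro j hj hjA
        exfalso
        by_cases hj2 : j = 2 * m
        · subst hj2
          exact H.loop _ hjA
        · have := all (2 * m - 1 - j) (by omega)
          rw [show 2 * m - 1 - (2 * m - 1 - j) = j by omega] at this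
          exact this hjA)
    omega
  have hX1 : A (2 * m) 1 := by
    have := hr1 0 (by omega)
    tauto
  have T := thr (A := A) (w := 2 * m) hm (fun i _ h => hr1 i h) H.adj hX1 hi (by
    intro j hj hjA
    have h1 : j ≠ 0 := by rintro rfl; exact n0X hjA
    have h2 : j ≠ 2 * m := by rintro rfl; exact H.loop _ hjA
    omega)
  have C : Cyc m A (Function.update (fun i => i) 0 (2 * m)) 0 :=
    (cyc0 H).replace H 0 (by omega) n0X nX0
  obtain ⟨ho', hi', hr'⟩ := C.rule H
  refine ⟨n0X, nX0, fun i h h' => (T i h h').1, fun i h h' => (T i h h').2, ?_, ho', hi', ?_, C⟩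
  · intro i h1 h2
    have := hr' i (by omega)
    rw [sc_lt h2] at this
    simpa [Function.update_apply, show i ≠ 0 by omega] using this
  · have := hr' 0 (by omega)
    rw [sc_lt (by omega)] at this
    simp only [Function.update_apply] at this
    simp at this
    tauto

theorem notlow {m k : ℕ} (H : Hyp m A) (B : Base m A) (hk : 1 ≤ k) (hk' : k < m)
    (h1 : ¬ A k 0) (h2 : ¬ A 0 k) : False := by
  have hk1 : k ≠ 1 := by rintro rfl; exact h2 B.a01
  have C := B.cyc.replace H k (by omega)
    (by rw [Function.update_of_ne (by omega)]; exact h1)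
    (by rw [Function.update_of_ne (by omega)]; exact h2)
  rw [Function.update_of_ne (by omega)] at C
  obtain ⟨-, -, hr⟩ := C.rule H
  have hlast := hr (2 * m - 1) (by omega)
  rw [sc_last (by omega)] at hlast
  simp only [Function.update_apply, show 2 * m - 1 ≠ k by omega, show 2 * m - 1 ≠ 0 by omega,
    show (0 : ℕ) ≠ k by omega, if_true, if_false] at hlast
  have hkX : ¬ A k (2 * m) := by
    rw [B.inX k hk (by omega)]; omega
  have hA := hlast.2 hkX
  have hk0 : A (k - 1) 0 := by
    have := B.ry (k - 1) (by omega) (by omega)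
    rw [show k - 1 + 1 = k by omega] at this
    tauto
  have key : ∀ j, m + 1 ≤ j → j < 2 * m → ¬ A 0 j := by
    intro j hj hj' h
    have p := ((((H.sg 1 (k - 1) (by omega) (by omega)).append hk0
      (H.sg 0 0 (by omega) (by omega)) (by
        intro j; simp only [Set.mem_Icc]; omega)).append h
      (H.sg j (2 * m - 1) (by omega) (by omega)) (by
        intro j; simp only [Set.mem_union, Set.mem_Icc]; omega)).append hA
      (H.sg k (j - 1) (by omega) (by omega)) (by
        intro j; simp only [Set.mem_union, Set.mem_Icc]; omega)).append
      ((B.inX (j - 1) (by omega) (by omega)).2 (by omega))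
      (H.sg (2 * m) (2 * m) (by omega) (by omega)) (by
        intro j; simp only [Set.mem_union, Set.mem_Icc]; omega)
    refine H.ham _ _ _ p ((B.outX 1 (by omega) (by omega)).2 (by omega)) ?_
    intro j; simp only [Set.mem_union, Set.mem_Icc]; omega
  have := out_le (A := A) (m := m) (w := 0) (c := m - 1) ((Finset.Icc 1 m).erase k)
    (by rw [Finset.card_erase_of_mem (by simp; omega), Nat.card_Icc]; omega) (by
      intro j hj hjA
      simp only [Finset.mem_erase, Finset.mem_Icc]
      have a1 : j ≠ k := by rintro rfl; exact h2 hjA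
      have a2 : j ≠ 0 := by rintro rfl; exact H.loop _ hjA
      have a3 : j ≠ 2 * m := by rintro rfl; exact B.n0X hjA
      have a4 : ¬ (m + 1 ≤ j) := fun h => key j h (by omega) hjA
      omega)
  have := B.out0
  omega

theorem nothigh {m k : ℕ} (H : Hyp m A) (B : Base m A) (hk : m < k) (hk' : k < 2 * m)
    (h1 : ¬ A k 0) (h2 : ¬ A 0 k) : False := by
  have hk1 : k ≠ 2 * m - 1 := by rintro rfl; exact h1 H.close
  have C := B.cyc.replace H k (by omega)
    (by rw [Function.update_of_ne (by omega)]; exact h1)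
    (by rw [Function.update_of_ne (by omega)]; exact h2)
  rw [Function.update_of_ne (by omega)] at C
  obtain ⟨-, -, hr⟩ := C.rule H
  have hm := H.pos
  have hfirst := hr 0 (by omega)
  rw [sc_lt (by omega)] at hfirst
  simp only [Function.update_apply, show 0 + 1 ≠ k by omega, show 0 + 1 ≠ 0 by omega,
    show (0 : ℕ) ≠ k by omega, if_true, if_false] at hfirst
  have hkX : ¬ A (2 * m) k := by
    rw [B.outX k (by omega) (by omega)]; omega
  have hA : A k 1 := by
    by_contra h
    exact hkX (hfirst.2 h)
  have hk0 : A 0 (k + 1) := by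
    have := B.ry k (by omega) (by omega)
    tauto
  have key : ∀ i, 1 ≤ i → i < m → ¬ A i 0 := by
    intro i hi hi' h
    have p := ((((H.sg 0 0 (by omega) (by omega)).append hk0
      (H.sg (k + 1) (2 * m - 1) (by omega) (by omega)) (by
        intro j; simp only [Set.mem_Icc]; omega)).append
      ((B.inX (2 * m - 1) (by omega) (by omega)).2 (by omega))
      (H.sg (2 * m) (2 * m) (by omega) (by omega)) (by
        intro j; simp only [Set.mem_union, Set.mem_Icc]; omega)).append
      ((B.outX (i + 1) (by omega) (by omega)).2 (by omega))
      (H.sg (i + 1) k (by omega) (by omega)) (by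
        intro j; simp only [Set.mem_union, Set.mem_Icc]; omega)).append hA
      (H.sg 1 i (by omega) (by omega)) (by
        intro j; simp only [Set.mem_union, Set.mem_Icc]; omega)
    refine H.ham _ _ _ p h ?_
    intro j; simp only [Set.mem_union, Set.mem_Icc]; omega
  have := in_le (A := A) (m := m) (w := 0) (c := m - 1) ((Finset.Icc m (2 * m - 1)).erase k)
    (by rw [Finset.card_erase_of_mem (by simp; omega), Nat.card_Icc]; omega) (by
      intro j hj hjA
      simp only [Finset.mem_erase, Finset.mem_Icc]
      have a1 : j ≠ k := by rintro rfl; exact h1 hjA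
      have a2 : j ≠ 0 := by rintro rfl; exact H.loop _ hjA
      have a3 : j ≠ 2 * m := by rintro rfl; exact B.nX0 hjA
      have a4 : ¬ (j < m) := fun h => key j (by omega) h hjA
      omega)
  have := B.in0
  omega

/-- The `L₂` alternative in label world. -/
def CaseL2 (m : ℕ) (A : ℕ → ℕ → Prop) : Prop :=
  (∀ i, 1 ≤ i → i < 2 * m → (A i 0 ↔ m ≤ i)) ∧ (∀ i, 1 ≤ i → i < 2 * m → (A 0 i ↔ i ≤ m)) ∧
  (∀ i j, 1 ≤ i → i < m → m < j → j < 2 * m → ¬ A i j)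

theorem caseL2 {m : ℕ} (H : Hyp m A) (B : Base m A)
    (h : ∀ k, 1 ≤ k → k < 2 * m → A 0 k ∨ A k 0) : CaseL2 m A := by
  have hm := H.pos
  have T := thr (A := A) (w := 0) hm B.ry h B.a01 B.in0 (by
    intro j hj hjA
    have a2 : j ≠ 0 := by rintro rfl; exact H.loop _ hjA
    have a3 : j ≠ 2 * m := by rintro rfl; exact B.nX0 hjA
    omega)
  refine ⟨fun i h h' => (T i h h').1, fun i h h' => (T i h h').2, ?_⟩
  intro i j hi hi' hj hj' hA
  have p := ((((H.sg 0 0 (by omega) (by omega)).append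
      ((T (i + 1) (by omega) (by omega)).2.2 (by omega))
      (H.sg (i + 1) (j - 1) (by omega) (by omega)) (by
        intro j; simp only [Set.mem_Icc]; omega)).append
      ((B.inX (j - 1) (by omega) (by omega)).2 (by omega))
      (H.sg (2 * m) (2 * m) (by omega) (by omega)) (by
        intro j; simp only [Set.mem_union, Set.mem_Icc]; omega)).append
      ((B.outX 1 (by omega) (by omega)).2 (by omega))
      (H.sg 1 i (by omega) (by omega)) (by
        intro j; simp only [Set.mem_union, Set.mem_Icc]; omega)).append hA
      (H.sg j (2 * m - 1) (by omega) (by omega)) (by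
        intro j; simp only [Set.mem_union, Set.mem_Icc]; omega)
  refine H.ham _ _ _ p H.close ?_
  intro j; simp only [Set.mem_union, Set.mem_Icc]; omega

/-- Facts when `z = x_m` is not adjacent to `y`. -/
structure Mid (m : ℕ) (A : ℕ → ℕ → Prop) (a b : ℕ) : Prop where
  m2 : 2 ≤ m
  a1 : 1 ≤ a
  am : a < m
  ab : a + b = 2 * m
  nm0 : ¬ A m 0
  n0m : ¬ A 0 m
  in1 : ∀ i, 1 ≤ i → i < m → (A i 0 ↔ a ≤ i)
  out1 : ∀ i, 1 ≤ i → i < m → (A 0 i ↔ i ≤ a)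
  in2 : ∀ i, m < i → i < 2 * m → (A i 0 ↔ b ≤ i)
  out2 : ∀ i, m < i → i < 2 * m → (A 0 i ↔ i ≤ b)
  inz1 : ∀ i, 1 ≤ i → i < m → (A i m ↔ i = m - 1)
  outz1 : ∀ i, 1 ≤ i → i < m → (A m i ↔ 2 ≤ i)
  inz2 : ∀ i, m < i → i < 2 * m → (A i m ↔ i < 2 * m - 1)
  outz2 : ∀ i, m < i → i < 2 * m → (A m i ↔ i = m + 1)
  cyc : Cyc m A (Function.update (Function.update (fun i => i) 0 (2 * m)) m 0) m

/-- Threshold in one segment. -/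
theorem segthr {s t : ℕ} (hst : s ≤ t)
    (hr : ∀ i, s ≤ i → i < t → (A i 0 ↔ ¬ A 0 (i + 1)))
    (hadj : ∀ i, s ≤ i → i ≤ t → A 0 i ∨ A i 0) (h1 : A 0 s) (h2 : A t 0) :
    ∃ a, s ≤ a ∧ a ≤ t ∧ ∀ i, s ≤ i → i ≤ t → ((A i 0 ↔ a ≤ i) ∧ (A 0 i ↔ i ≤ a)) := by
  classical
  have hex : ∃ i, s ≤ i ∧ A i 0 := ⟨t, hst, h2⟩
  obtain ⟨ha1, ha2⟩ := Nat.find_spec hex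
  have hmin : ∀ i, s ≤ i → i < Nat.find hex → ¬ A i 0 := fun i hi h hA =>
    Nat.find_min hex h ⟨hi, hA⟩
  have hat : Nat.find hex ≤ t := Nat.find_min' hex ⟨hst, h2⟩
  generalize Nat.find hex = a at *
  have up : ∀ d, a + d ≤ t → A (a + d) 0 := by
    intro d
    induction d with
    | zero => intro _; exact ha2
    | succ d ih =>
      intro hd
      have g1 := ih (by omega)
      have g2 := hr (a + d) (by omega) (by omega)
      have g3 := hadj (a + d + 1) (by omega) (by omega)
      show A (a + d + 1) 0
      tauto
  have main : ∀ i, s ≤ i → i ≤ t → (A i 0 ↔ a ≤ i) := by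
    intro i hi hi'
    constructor
    · intro h
      by_contra hlt
      exact hmin i hi (by omega) h
    · intro h
      have := up (i - a) (by omega)
      rwa [show a + (i - a) = i by omega] at this
  refine ⟨a, ha1, hat, ?_⟩
  intro i hi hi'
  refine ⟨main i hi hi', ?_⟩
  by_cases h : i = s
  · subst h
    exact ⟨fun _ => ha1, fun _ => h1⟩
  · have h2 := hr (i - 1) (by omega) (by omega)
    have h3 := main (i - 1) (by omega) (by omega)
    rw [show i - 1 + 1 = i by omega] at h2
    constructor
    · intro h4
      by_contra h5
      exact (h2.1 (h3.2 (by omega))) h4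
    · intro h4
      by_contra h5
      have := h3.1 (h2.2 h5)
      omega

theorem mid {m : ℕ} (H : Hyp m A) (B : Base m A) (nm0 : ¬ A m 0) (n0m : ¬ A 0 m) :
    ∃ a b, Mid m A a b := by
  have hm := H.pos
  have hm2 : m ≠ 1 := by rintro rfl; exact n0m B.a01
  have hadj : ∀ k, 1 ≤ k → k < 2 * m → k ≠ m → A 0 k ∨ A k 0 := by
    intro k h1 h2 h3
    by_contra h
    push Not at h
    rcases lt_or_gt_of_ne h3 with h4 | h4
    · exact notlow H B h1 h4 h.2 h.1
    · exact nothigh H B h4 h2 h.2 h.1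
  have hm1 : A (m - 1) 0 := by
    have := B.ry (m - 1) (by omega) (by omega)
    rw [show m - 1 + 1 = m by omega] at this
    tauto
  have hm3 : A 0 (m + 1) := by
    have := B.ry m (by omega) (by omega)
    tauto
  obtain ⟨a, ha1, ha2, ha⟩ := segthr (A := A) (s := 1) (t := m - 1) (by omega)
    (fun i h h' => B.ry i h (by omega)) (fun i h h' => hadj i h (by omega) (by omega)) B.a01 hm1
  obtain ⟨b, hb1, hb2, hb⟩ := segthr (A := A) (s := m + 1) (t := 2 * m - 1) (by omega)
    (fun i h h' => B.ry i (by omega) (by omega))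
    (fun i h h' => hadj i (by omega) (by omega) (by omega)) hm3 H.close
  have C := B.cyc.replace H m (by omega)
    (by rw [Function.update_of_ne (by omega)]; exact nm0)
    (by rw [Function.update_of_ne (by omega)]; exact n0m)
  rw [Function.update_of_ne (by omega)] at C
  have hdisj : Disjoint (Finset.Icc a (m - 1)) (Finset.Icc b (2 * m - 1)) := by
    rw [Finset.disjoint_left]
    intro j
    simp only [Finset.mem_Icc]
    omega
  have hcard : (Finset.Icc a (m - 1) ∪ Finset.Icc b (2 * m - 1)).card
      = (m - a) + (2 * m - b) := by
    rw [Finset.card_union_of_disjoint hdisj, Nat.card_Icc, Nat.card_Icc]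
    omega
  have c1 : inC A m 0 ≤ (m - a) + (2 * m - b) := in_le _ hcard.le (by
    intro j hj hjA
    simp only [Finset.mem_union, Finset.mem_Icc]
    have q1 : j ≠ m := by rintro rfl; exact nm0 hjA
    have q2 : j ≠ 0 := by rintro rfl; exact H.loop _ hjA
    have q3 : j ≠ 2 * m := by rintro rfl; exact B.nX0 hjA
    by_cases q4 : j < m
    · have := (ha j (by omega) (by omega)).1.1 hjA
      omega
    · have := (hb j (by omega) (by omega)).1.1 hjA
      omega)
  have c2 : (m - a) + (2 * m - b) ≤ inC A m 0 := le_in _ hcard.ge (by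
    intro j hj
    simp only [Finset.mem_union, Finset.mem_Icc] at hj
    refine ⟨by omega, ?_⟩
    rcases hj with hj | hj
    · exact (ha j (by omega) (by omega)).1.2 (by omega)
    · exact (hb j (by omega) (by omega)).1.2 (by omega))
  have c3 := B.in0
  obtain ⟨-, -, hr⟩ := C.rule H
  have r0 := hr 0 (by omega)
  rw [sc_lt (by omega)] at r0
  simp only [Function.update_apply, show 0 + 1 ≠ m by omega, show 0 + 1 ≠ 0 by omega,
    show (0 : ℕ) ≠ m by omega, if_true, if_false] at r0
  have nm1 : ¬ A m 1 := r0.1 ((B.outX m (by omega) (by omega)).2 (by omega))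
  have rl := hr (2 * m - 1) (by omega)
  rw [sc_last (by omega)] at rl
  simp only [Function.update_apply, show 2 * m - 1 ≠ m by omega, show 2 * m - 1 ≠ 0 by omega,
    show (0 : ℕ) ≠ m by omega, if_true, if_false] at rl
  have nlm : ¬ A (2 * m - 1) m := fun h =>
    rl.1 h ((B.inX m (by omega) (by omega)).2 (by omega))
  have ri : ∀ i, 1 ≤ i → i + 1 < 2 * m → i ≠ m → i + 1 ≠ m → (A i m ↔ ¬ A m (i + 1)) := by
    intro i h1 h2 h3 h4
    have := hr i (by omega)
    rw [sc_lt (by omega)] at this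
    simpa only [Function.update_apply, h3, h4, show i ≠ 0 by omega, show i + 1 ≠ 0 by omega,
      if_false] using this
  have k1 : ∀ i, 1 ≤ i → i + 1 < m → ¬ A i m := by
    intro i h1 h2 hA
    have p := (((((H.sg (2 * m) (2 * m) (by omega) (by omega)).append
      ((B.outX (i + 1) (by omega) (by omega)).2 (by omega))
      (H.sg (i + 1) (m - 1) (by omega) (by omega)) (by
        intro j; simp only [Set.mem_Icc]; omega)).append hm1
      (H.sg 0 0 (by omega) (by omega)) (by
        intro j; simp only [Set.mem_union, Set.mem_Icc]; omega)).append B.a01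
      (H.sg 1 i (by omega) (by omega)) (by
        intro j; simp only [Set.mem_union, Set.mem_Icc]; omega)).append hA
      (H.sg m (2 * m - 1) (by omega) (by omega)) (by
        intro j; simp only [Set.mem_union, Set.mem_Icc]; omega))
    refine H.ham _ _ _ p ((B.inX (2 * m - 1) (by omega) (by omega)).2 (by omega)) ?_
    intro j; simp only [Set.mem_union, Set.mem_Icc]; omega
  have k2 : ∀ j, m + 2 ≤ j → j < 2 * m → ¬ A m j := by
    intro j h1 h2 hA
    have p := (((((H.sg 0 0 (by omega) (by omega)).append hm3
      (H.sg (m + 1) (j - 1) (by omega) (by omega)) (by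
        intro j; simp only [Set.mem_Icc]; omega)).append
      ((B.inX (j - 1) (by omega) (by omega)).2 (by omega))
      (H.sg (2 * m) (2 * m) (by omega) (by omega)) (by
        intro j; simp only [Set.mem_union, Set.mem_Icc]; omega)).append
      ((B.outX 1 (by omega) (by omega)).2 (by omega))
      (H.sg 1 m (by omega) (by omega)) (by
        intro j; simp only [Set.mem_union, Set.mem_Icc]; omega)).append hA
      (H.sg j (2 * m - 1) (by omega) (by omega)) (by
        intro j; simp only [Set.mem_union, Set.mem_Icc]; omega))
    refine H.ham _ _ _ p H.close ?_
    intro j; simp only [Set.mem_union, Set.mem_Icc]; omega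
  refine ⟨a, b, by omega, ha1, by omega, by omega, nm0, n0m,
    fun i h h' => (ha i h (by omega)).1, fun i h h' => (ha i h (by omega)).2,
    fun i h h' => (hb i h (by omega)).1, fun i h h' => (hb i h (by omega)).2, ?_, ?_, ?_, ?_, C⟩
  · intro i h1 h2
    constructor
    · intro h
      by_contra h3
      exact k1 i h1 (by omega) h
    · rintro rfl
      have := H.arc (m - 1) (by omega)
      rwa [show m - 1 + 1 = m by omega] at this
  · intro i h1 h2
    constructor
    · intro h
      by_contra h3
      rw [show i = 1 by omega] at h
      exact nm1 h
    · intro h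
      have q1 := ri (i - 1) (by omega) (by omega) (by omega) (by omega)
      rw [show i - 1 + 1 = i by omega] at q1
      have q2 := k1 (i - 1) (by omega) (by omega)
      tauto
  · intro i h1 h2
    constructor
    · intro h
      by_contra h3
      rw [show i = 2 * m - 1 by omega] at h
      exact nlm h
    · intro h
      have q1 := ri i (by omega) (by omega) (by omega) (by omega)
      have q2 := k2 (i + 1) (by omega) (by omega)
      tauto
  · intro i h1 h2
    constructor
    · intro h
      by_contra h3
      exact k2 i (by omega) h2 h
    · rintro rfl
      exact H.arc m (by omega)

/-- Table for order 7. -/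
def tab7 : List (ℕ × ℕ) :=
  [(0,1),(0,4),(0,5),(1,0),(1,2),(1,5),(2,0),(2,3),(2,4),(3,2),(3,4),(3,6),
   (4,3),(4,5),(4,6),(5,0),(5,1),(5,6),(6,1),(6,2),(6,3)]

/-- Table for order 5 (up to the two free arcs). -/
def tab5 : List (ℕ × ℕ) :=
  [(0,1),(0,3),(1,0),(1,2),(2,3),(2,4),(3,0),(3,4),(4,1),(4,2)]

theorem big_a {m a b : ℕ} (H : Hyp m A) (B : Base m A) (M : Mid m A a b) (hm : 3 ≤ m) :
    a = 1 := by
  by_contra hne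
  have ha1 := M.a1
  have ham := M.am
  have hab := M.ab
  have n1 : ¬ A (2 * m - 1) m := by rw [M.inz2 _ (by omega) (by omega)]; omega
  have n2 : ¬ A m (2 * m - 1) := by rw [M.outz2 _ (by omega) (by omega)]; omega
  have C := M.cyc.replace H (2 * m - 1) (by omega)
    (by rw [Function.update_of_ne (by omega), Function.update_of_ne (by omega)]; exact n1)
    (by rw [Function.update_of_ne (by omega), Function.update_of_ne (by omega)]; exact n2)
  rw [Function.update_of_ne (by omega), Function.update_of_ne (by omega)] at C
  obtain ⟨hout, -, hr⟩ := C.rule H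
  have rm := hr m (by omega)
  rw [sc_lt (by omega)] at rm
  simp only [Function.update_apply, show m ≠ 2 * m - 1 by omega, show m + 1 ≠ 2 * m - 1 by omega,
    show m + 1 ≠ m by omega, show m + 1 ≠ 0 by omega, if_true, if_false] at rm
  have n3 : ¬ A 0 (2 * m - 1) := by rw [M.out2 _ (by omega) (by omega)]; omega
  have w1 : A (2 * m - 1) (m + 1) := by tauto
  by_cases hb : m + 2 ≤ b
  · have p := ((((((H.sg 0 0 (by omega) (by omega)).append
      ((M.out2 (m + 2) (by omega) (by omega)).2 hb)
      (H.sg (m + 2) (2 * m - 1) (by omega) (by omega)) (by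
        intro j; simp only [Set.mem_Icc]; omega)).append w1
      (H.sg (m + 1) (m + 1) (by omega) (by omega)) (by
        intro j; simp only [Set.mem_union, Set.mem_Icc]; omega)).append
      ((M.inz2 (m + 1) (by omega) (by omega)).2 (by omega))
      (H.sg m m (by omega) (by omega)) (by
        intro j; simp only [Set.mem_union, Set.mem_Icc]; omega)).append
      ((B.inX m (by omega) (by omega)).2 (by omega))
      (H.sg (2 * m) (2 * m) (by omega) (by omega)) (by
        intro j; simp only [Set.mem_union, Set.mem_Icc]; omega)).append
      ((B.outX 1 (by omega) (by omega)).2 (by omega))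
      (H.sg 1 (m - 1) (by omega) (by omega)) (by
        intro j; simp only [Set.mem_union, Set.mem_Icc]; omega))
    refine H.ham _ _ _ p ((M.in1 (m - 1) (by omega) (by omega)).2 (by omega)) ?_
    intro j; simp only [Set.mem_union, Set.mem_Icc]; omega
  · have k1 : ∀ i, 1 ≤ i → i + 1 < m → ¬ A i (2 * m - 1) := by
      intro i h1 h2 hA
      have p := ((((((H.sg 0 0 (by omega) (by omega)).append
        ((M.out1 (i + 1) (by omega) (by omega)).2 (by omega))
        (H.sg (i + 1) (m - 1) (by omega) (by omega)) (by
          intro j; simp only [Set.mem_Icc]; omega)).append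
        ((M.inz1 (m - 1) (by omega) (by omega)).2 rfl)
        (H.sg m (2 * m - 2) (by omega) (by omega)) (by
          intro j; simp only [Set.mem_union, Set.mem_Icc]; omega)).append
        ((B.inX (2 * m - 2) (by omega) (by omega)).2 (by omega))
        (H.sg (2 * m) (2 * m) (by omega) (by omega)) (by
          intro j; simp only [Set.mem_union, Set.mem_Icc]; omega)).append
        ((B.outX 1 (by omega) (by omega)).2 (by omega))
        (H.sg 1 i (by omega) (by omega)) (by
          intro j; simp only [Set.mem_union, Set.mem_Icc]; omega)).append hA
        (H.sg (2 * m - 1) (2 * m - 1) (by omega) (by omega)) (by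
          intro j; simp only [Set.mem_union, Set.mem_Icc]; omega))
      refine H.ham _ _ _ p H.close ?_
      intro j; simp only [Set.mem_union, Set.mem_Icc]; omega
    have k2 : ∀ i, 2 ≤ i → i < m → A (2 * m - 1) i := by
      intro i h1 h2
      have r := hr (i - 1) (by omega)
      rw [sc_lt (by omega)] at r
      simp only [Function.update_apply, show i - 1 ≠ 2 * m - 1 by omega,
        show i - 1 + 1 ≠ 2 * m - 1 by omega, show i - 1 ≠ m by omega, show i - 1 ≠ 0 by omega,
        show i - 1 + 1 ≠ m by omega, show i - 1 + 1 ≠ 0 by omega, if_false] at r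
      rw [show i - 1 + 1 = i by omega] at r
      have := k1 (i - 1) (by omega) (by omega)
      tauto
    have hX : A (2 * m - 1) (2 * m) := (B.inX _ (by omega) (by omega)).2 (by omega)
    have : m + 1 ≤ outC A m (2 * m - 1) :=
      le_out (insert 0 (insert (m + 1) (insert (2 * m) (Finset.Icc 2 (m - 1)))))
        (by
          rw [Finset.card_insert_of_notMem, Finset.card_insert_of_notMem,
            Finset.card_insert_of_notMem, Nat.card_Icc]
          · omega
          · simp only [Finset.mem_Icc]; omega
          · simp only [Finset.mem_Icc, Finset.mem_insert]; omega
          · simp only [Finset.mem_Icc, Finset.mem_insert]; omega) (by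
        intro j hj
        simp only [Finset.mem_Icc, Finset.mem_insert] at hj
        rcases hj with rfl | rfl | rfl | hj
        · exact ⟨by omega, H.close⟩
        · exact ⟨by omega, w1⟩
        · exact ⟨by omega, hX⟩
        · exact ⟨by omega, k2 j (by omega) (by omega)⟩)
    omega

theorem ucyc {m b : ℕ} (H : Hyp m A) (M : Mid m A 1 b) (hm : 3 ≤ m) :
    Cyc m A (Function.update (Function.update (Function.update (fun i => i) 0 (2 * m)) m 0) 1 m)
      1 := by
  have n1 : ¬ A 1 m := by rw [M.inz1 _ (by omega) (by omega)]; omega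
  have n2 : ¬ A m 1 := by rw [M.outz1 _ (by omega) (by omega)]; omega
  have C := M.cyc.replace H 1 (by omega)
    (by rw [Function.update_of_ne (by omega), Function.update_of_ne (by omega)]; exact n1)
    (by rw [Function.update_of_ne (by omega), Function.update_of_ne (by omega)]; exact n2)
  rwa [Function.update_of_ne (by omega), Function.update_of_ne (by omega)] at C

theorem uout {m b : ℕ} (H : Hyp m A) (B : Base m A) (M : Mid m A 1 b) (hm : 3 ≤ m) :
    (∀ j, m + 1 ≤ j → j ≤ 2 * m - 2 → ¬ A j 1) ∧
    (∀ j, j ≤ 2 * m → (A 1 j ↔ j = 0 ∨ j = 2 ∨ (m + 2 ≤ j ∧ j < 2 * m))) := by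
  have hab := M.ab
  obtain ⟨hout, -, hr⟩ := (ucyc H M hm).rule H
  have k1 : ∀ j, m + 1 ≤ j → j ≤ 2 * m - 2 → ¬ A j 1 := by
    intro j h1 h2 hA
    have p := ((((((H.sg 1 1 (by omega) (by omega)).append
        ((M.in1 1 (by omega) (by omega)).2 (by omega))
        (H.sg 0 0 (by omega) (by omega)) (by
          intro j; simp only [Set.mem_Icc]; omega)).append
        ((M.out2 (j + 1) (by omega) (by omega)).2 (by omega))
        (H.sg (j + 1) (2 * m - 1) (by omega) (by omega)) (by
          intro j; simp only [Set.mem_union, Set.mem_Icc]; omega)).append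
        ((B.inX (2 * m - 1) (by omega) (by omega)).2 (by omega))
        (H.sg (2 * m) (2 * m) (by omega) (by omega)) (by
          intro j; simp only [Set.mem_union, Set.mem_Icc]; omega)).append
        ((B.outX 2 (by omega) (by omega)).2 (by omega))
        (H.sg 2 j (by omega) (by omega)) (by
          intro j; simp only [Set.mem_union, Set.mem_Icc]; omega)))
    refine H.ham _ _ _ p hA ?_
    intro j; simp only [Set.mem_union, Set.mem_Icc]; omega
  have k2 : ∀ j, m + 2 ≤ j → j < 2 * m → A 1 j := by
    intro j h1 h2
    have r := hr (j - 1) (by omega)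
    rw [sc_lt (by omega)] at r
    simp only [Function.update_apply, show j - 1 ≠ 1 by omega,
        show j - 1 + 1 ≠ 1 by omega, show j - 1 ≠ m by omega, show j - 1 ≠ 0 by omega,
        show j - 1 + 1 ≠ m by omega, show j - 1 + 1 ≠ 0 by omega, if_false] at r
    rw [show j - 1 + 1 = j by omega] at r
    have := k1 (j - 1) (by omega) (by omega)
    tauto
  have a10 : A 1 0 := (M.in1 1 (by omega) (by omega)).2 (by omega)
  have a12 : A 1 2 := H.arc 1 (by omega)
  refine ⟨k1, ?_⟩
  intro j hj
  constructor
  · intro hA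
    by_contra hcon
    have : m + 1 ≤ outC A m 1 :=
      le_out (insert j (insert 0 (insert 2 (Finset.Icc (m + 2) (2 * m - 1)))))
        (by
          rw [Finset.card_insert_of_notMem, Finset.card_insert_of_notMem,
            Finset.card_insert_of_notMem, Nat.card_Icc]
          · omega
          · simp only [Finset.mem_Icc]; omega
          · simp only [Finset.mem_Icc, Finset.mem_insert]; omega
          · simp only [Finset.mem_Icc, Finset.mem_insert]; omega) (by
        intro i hi
        simp only [Finset.mem_Icc, Finset.mem_insert] at hi
        rcases hi with rfl | rfl | rfl | hi
        · exact ⟨by omega, hA⟩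
        · exact ⟨by omega, a10⟩
        · exact ⟨by omega, a12⟩
        · exact ⟨by omega, k2 i (by omega) (by omega)⟩)
    omega
  · rintro (rfl | rfl | h)
    · exact a10
    · exact a12
    · exact k2 j h.1 h.2

theorem big_m {m b : ℕ} (H : Hyp m A) (B : Base m A) (M : Mid m A 1 b) (hm : 4 ≤ m) : False := by
  have hab := M.ab
  obtain ⟨-, -, hr⟩ := (ucyc H M (by omega)).rule H
  obtain ⟨-, ho⟩ := uout H B M (by omega)
  have r := hr 2 (by omega)
  rw [sc_lt (by omega)] at r
  simp only [Function.update_apply, show (2 : ℕ) ≠ 1 by omega, show 2 + 1 ≠ 1 by omega,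
    show 2 ≠ m by omega, show 2 + 1 ≠ m by omega, show (2 : ℕ) ≠ 0 by omega,
    show 2 + 1 ≠ 0 by omega, if_false] at r
  have h21 : A 2 1 := by
    rw [r, ho _ (by omega)]
    omega
  have p := ((((((H.sg 2 2 (by omega) (by omega)).append h21
        (H.sg 1 1 (by omega) (by omega)) (by
          intro j; simp only [Set.mem_Icc]; omega)).append
        ((M.in1 1 (by omega) (by omega)).2 (by omega))
        (H.sg 0 0 (by omega) (by omega)) (by
          intro j; simp only [Set.mem_union, Set.mem_Icc]; omega)).append
        ((M.out2 (m + 1) (by omega) (by omega)).2 (by omega))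
        (H.sg (m + 1) (2 * m - 1) (by omega) (by omega)) (by
          intro j; simp only [Set.mem_union, Set.mem_Icc]; omega)).append
        ((B.inX (2 * m - 1) (by omega) (by omega)).2 (by omega))
        (H.sg (2 * m) (2 * m) (by omega) (by omega)) (by
          intro j; simp only [Set.mem_union, Set.mem_Icc]; omega)).append
        ((B.outX 3 (by omega) (by omega)).2 (by omega))
        (H.sg 3 m (by omega) (by omega)) (by
          intro j; simp only [Set.mem_union, Set.mem_Icc]; omega))
  refine H.ham _ _ _ p ((M.outz1 2 (by omega) (by omega)).2 (by omega)) ?_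
  intro j; simp only [Set.mem_union, Set.mem_Icc]; omega

theorem case5 {a b : ℕ} (H : Hyp 2 A) (B : Base 2 A) (M : Mid 2 A a b) :
    ∀ i j, i ≤ 4 → j ≤ 4 → (i, j) ≠ (1, 3) → (i, j) ≠ (3, 1) → (A i j ↔ (i, j) ∈ tab5) := by
  have ha1 := M.a1
  have ham := M.am
  have hab := M.ab
  obtain rfl : a = 1 := by omega
  obtain rfl : b = 3 := by omega
  have e04 := B.n0X
  have e40 := B.nX0
  have e14 := B.inX 1 (by omega) (by omega)
  have e24 := B.inX 2 (by omega) (by omega)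
  have e34 := B.inX 3 (by omega) (by omega)
  have e41 := B.outX 1 (by omega) (by omega)
  have e42 := B.outX 2 (by omega) (by omega)
  have e43 := B.outX 3 (by omega) (by omega)
  have e20 := M.nm0
  have e02 := M.n0m
  have e10 := M.in1 1 (by omega) (by omega)
  have e01 := M.out1 1 (by omega) (by omega)
  have e30 := M.in2 3 (by omega) (by omega)
  have e03 := M.out2 3 (by omega) (by omega)
  have e12 := M.inz1 1 (by omega) (by omega)
  have e21 := M.outz1 1 (by omega) (by omega)
  have e32 := M.inz2 3 (by omega) (by omega)
  have e23 := M.outz2 3 (by omega) (by omega)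
  have l := H.loop
  norm_num at e04 e40 e14 e24 e34 e41 e42 e43 e10 e01 e30 e03 e12 e21 e32 e23
  intro i j hi hj h1 h2
  interval_cases i <;> interval_cases j <;> simp_all [tab5]

set_option maxHeartbeats 2000000 in
theorem case7 {b : ℕ} (H : Hyp 3 A) (B : Base 3 A) (M : Mid 3 A 1 b) :
    ∀ i j, i ≤ 6 → j ≤ 6 → (A i j ↔ (i, j) ∈ tab7) := by
  have hab := M.ab
  obtain rfl : b = 5 := by omega
  have l := H.loop
  have e06 := B.n0X
  have e60 := B.nX0
  have e16 := B.inX 1 (by omega) (by omega)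
  have e26 := B.inX 2 (by omega) (by omega)
  have e36 := B.inX 3 (by omega) (by omega)
  have e46 := B.inX 4 (by omega) (by omega)
  have e56 := B.inX 5 (by omega) (by omega)
  have e61 := B.outX 1 (by omega) (by omega)
  have e62 := B.outX 2 (by omega) (by omega)
  have e63 := B.outX 3 (by omega) (by omega)
  have e64 := B.outX 4 (by omega) (by omega)
  have e65 := B.outX 5 (by omega) (by omega)
  have e30 := M.nm0
  have e03 := M.n0m
  have e10 := M.in1 1 (by omega) (by omega)
  have e20 := M.in1 2 (by omega) (by omega)
  have e01 := M.out1 1 (by omega) (by omega)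
  have e02 := M.out1 2 (by omega) (by omega)
  have e40 := M.in2 4 (by omega) (by omega)
  have e50 := M.in2 5 (by omega) (by omega)
  have e04 := M.out2 4 (by omega) (by omega)
  have e05 := M.out2 5 (by omega) (by omega)
  have e13 := M.inz1 1 (by omega) (by omega)
  have e23 := M.inz1 2 (by omega) (by omega)
  have e31 := M.outz1 1 (by omega) (by omega)
  have e32 := M.outz1 2 (by omega) (by omega)
  have e43 := M.inz2 4 (by omega) (by omega)
  have e53 := M.inz2 5 (by omega) (by omega)
  have e34 := M.outz2 4 (by omega) (by omega)
  have e35 := M.outz2 5 (by omega) (by omega)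
  obtain ⟨ho1, ho⟩ := uout H B M (by omega)
  have e41 := ho1 4 (by omega) (by omega)
  have e12 := ho 2 (by omega)
  have e14 := ho 4 (by omega)
  have e15 := ho 5 (by omega)
  have e45 : A 4 5 := H.arc 4 (by omega)
  obtain ⟨-, -, hu⟩ := (ucyc H M (by omega)).rule H
  have u2 := hu 2 (by omega)
  have u5 := hu 5 (by omega)
  norm_num at e06 e60 e16 e26 e36 e46 e56 e61 e62 e63 e64 e65 e10 e20 e01 e02 e40 e50 e04 e05
  norm_num at e13 e23 e31 e32 e43 e53 e34 e35 e12 e14 e15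
  norm_num [sc, Function.update_apply] at u2 u5
  have C := M.cyc.replace H 5 (by omega)
    (by norm_num [Function.update_apply]; exact e53)
    (by norm_num [Function.update_apply]; exact e35)
  norm_num [Function.update_apply] at C
  obtain ⟨-, -, hw⟩ := C.rule H
  have w0 := hw 0 (by omega)
  have w1 := hw 1 (by omega)
  have w2 := hw 2 (by omega)
  have w3 := hw 3 (by omega)
  norm_num [sc, Function.update_apply] at w0 w1 w2 w3
  have e21 : ¬ A 2 1 := fun h => u2.1 h e10
  have e51 : A 5 1 := u5.2 e16
  have e54 : ¬ A 5 4 := w3.1 e05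
  have e52 : ¬ A 5 2 := w1.1 e15
  have e25 : ¬ A 2 5 := fun h => w2.1 h e50
  have e42 : ¬ A 4 2 := by
    intro h
    have p := ((((((H.sg 6 6 (by omega) (by omega)).append e61
        (H.sg 1 1 (by omega) (by omega)) (by
          intro j; simp only [Set.mem_Icc]; omega)).append e15
        (H.sg 5 5 (by omega) (by omega)) (by
          intro j; simp only [Set.mem_union, Set.mem_Icc]; omega)).append e50
        (H.sg 0 0 (by omega) (by omega)) (by
          intro j; simp only [Set.mem_union, Set.mem_Icc]; omega)).append e04
        (H.sg 4 4 (by omega) (by omega)) (by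
          intro j; simp only [Set.mem_union, Set.mem_Icc]; omega)).append h
        (H.sg 2 3 (by omega) (by omega)) (by
          intro j; simp only [Set.mem_union, Set.mem_Icc]; omega))
    refine H.ham _ _ _ p e36 ?_
    intro j; simp only [Set.mem_union, Set.mem_Icc]; omega
  have e24 : A 2 4 := by
    by_contra h
    have p := ((((((H.sg 6 6 (by omega) (by omega)).append e61
        (H.sg 1 1 (by omega) (by omega)) (by
          intro j; simp only [Set.mem_Icc]; omega)).append e15
        (H.sg 5 5 (by omega) (by omega)) (by
          intro j; simp only [Set.mem_union, Set.mem_Icc]; omega)).append e50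
        (H.sg 0 0 (by omega) (by omega)) (by
          intro j; simp only [Set.mem_union, Set.mem_Icc]; omega)).append e04
        (H.sg 4 4 (by omega) (by omega)) (by
          intro j; simp only [Set.mem_union, Set.mem_Icc]; omega)).append e43
        (H.sg 3 3 (by omega) (by omega)) (by
          intro j; simp only [Set.mem_union, Set.mem_Icc]; omega))
    have q := (H.off 2 _ _ _ (by omega) p e36 (by
      intro j; simp only [Set.mem_union, Set.mem_Icc]; omega)).1
    have : outC A 3 2 ≤ 2 := out_le {0, 3} (by simp) (by
      intro j hj hjA
      clear ho ho1 hu hw u2 u5 w0 w1 w2 w3 C B M H hab p q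
      interval_cases j <;> simp_all)
    omega
  clear ho ho1 hu hw u2 u5 w0 w1 w2 w3 C B M H hab
  intro i j hi hj
  interval_cases i <;> interval_cases j <;> simp_all [tab7]

theorem final {m : ℕ} (H : Hyp m A) (B : Base m A) : CaseL2 m A ∨
    (m = 2 ∧ ∀ i j, i ≤ 4 → j ≤ 4 → (i, j) ≠ (1, 3) → (i, j) ≠ (3, 1) →
      (A i j ↔ (i, j) ∈ tab5)) ∨
    (m = 3 ∧ ∀ i j, i ≤ 6 → j ≤ 6 → (A i j ↔ (i, j) ∈ tab7)) := by
  by_cases h : ∀ k, 1 ≤ k → k < 2 * m → A 0 k ∨ A k 0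
  · left
    exact caseL2 H B h
  · right
    push Not at h
    obtain ⟨k, h1, h2, h3, h4⟩ := h
    have hk : k = m := by
      by_contra hne
      rcases lt_or_gt_of_ne hne with h5 | h5
      · exact notlow H B h1 h5 h4 h3
      · exact nothigh H B h5 h2 h4 h3
    subst hk
    obtain ⟨a, b, M⟩ := mid H B h4 h3
    have hm2 := M.m2
    by_cases hk2 : k = 2
    · left
      subst hk2
      exact ⟨rfl, case5 H B M⟩
    · right
      obtain rfl := big_a H B M (by omega)
      by_cases hk3 : k = 3
      · subst hk3
        exact ⟨rfl, case7 H B M⟩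
      · exact (big_m H B M (by omega)).elim

/-- A path as a function. -/
theorem Path.toFun {u v : ℕ} {S : Set ℕ} (h : Path A u v S) :
    ∃ (n : ℕ) (g : ℕ → ℕ), g 0 = u ∧ g n = v ∧ (∀ i ≤ n, ∀ j ≤ n, g i = g j → i = j) ∧
      (∀ i < n, A (g i) (g (i + 1))) ∧ (∀ j, j ∈ S ↔ ∃ i ≤ n, g i = j) := by
  induction h with
  | single u =>
    refine ⟨0, fun _ => u, rfl, rfl, fun i hi j hj _ => by omega, fun i hi => by omega, ?_⟩
    intro j
    constructor
    · intro h
      exact ⟨0, le_refl _, h.symm⟩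
    · rintro ⟨_, _, h⟩
      exact h.symm
  | cons u v w S h1 h2 h3 ih =>
    obtain ⟨n, g, g0, gn, ginj, garc, gS⟩ := ih
    refine ⟨n + 1, fun i => Nat.casesOn i u g, rfl, gn, ?_, ?_, ?_⟩
    · intro i hi j hj h
      rcases i with _ | i <;> rcases j with _ | j
      · rfl
      · exact absurd ((gS u).2 ⟨j, by omega, h.symm⟩) h2
      · exact absurd ((gS u).2 ⟨i, by omega, h⟩) h2
      · have := ginj i (by omega) j (by omega) h
        omega
    · intro i hi
      rcases i with _ | i
      · show A u (g 0)
        rwa [g0]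
      · exact garc i (by omega)
    · intro j
      constructor
      · rintro (rfl | h)
        · exact ⟨0, by omega, rfl⟩
        · obtain ⟨i, hi, rfl⟩ := (gS j).1 h
          exact ⟨i + 1, by omega, rfl⟩
      · rintro ⟨i, hi, h⟩
        rcases i with _ | i
        · left; exact h.symm
        · right
          exact (gS j).2 ⟨i, by omega, h⟩

end Lab

open Lab

theorem cyc_of_path {V : Type*} (D : Dgr V) (f : ℕ → V) (N : ℕ)
    (finj : ∀ i ≤ N, ∀ j ≤ N, f i = f j → i = j) {u v : ℕ} {S : Set ℕ}
    (h : Path (fun i j => D.Arc (f i) (f j)) u v S) (hvu : D.Arc (f v) (f u))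
    (hS : ∀ j ∈ S, j ≤ N) : D.CycleThrough (f '' S) := by
  obtain ⟨n, g, g0, gn, ginj, garc, gS⟩ := h.toFun
  have hn : n ≠ 0 := by
    rintro rfl
    rw [g0] at gn
    subst gn
    exact D.loopless _ hvu
  have gN : ∀ i ≤ n, g i ≤ N := fun i hi => hS _ ((gS _).2 ⟨i, hi, rfl⟩)
  have vl : ∀ i : ZMod (n + 1), i.val ≤ n := fun i => by have := i.val_lt; omega
  refine ⟨n + 1, fun i => f (g i.val), ⟨by omega, ?_, ?_⟩, ?_⟩
  · intro i j hij
    have := ginj _ (vl i) _ (vl j) (finj _ (gN _ (vl i)) _ (gN _ (vl j)) hij)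
    exact ZMod.val_injective _ this
  · intro i
    show D.Arc (f (g i.val)) (f (g (i + 1).val))
    have h1 : (1 : ZMod (n + 1)).val = 1 := by
      rw [ZMod.val_one_eq_one_mod, Nat.mod_eq_of_lt (by omega)]
    have hv := vl i
    rw [ZMod.val_add, h1]
    by_cases hi : i.val = n
    · rw [hi, Nat.mod_self, gn, g0]
      exact hvu
    · rw [Nat.mod_eq_of_lt (by omega)]
      exact garc _ (by omega)
  · rintro _ ⟨j, hj, rfl⟩
    obtain ⟨i, hi, rfl⟩ := (gS j).1 hj
    refine ⟨(i : ZMod (n + 1)), ?_⟩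
    show f (g _) = _
    rw [ZMod.val_natCast, Nat.mod_eq_of_lt (by omega)]

theorem CycleThrough_mono {V : Type*} (D : Dgr V) {S T : Set V} (h : D.CycleThrough S)
    (hT : T ⊆ S) : D.CycleThrough T := by
  obtain ⟨k, c, h1, h2⟩ := h
  exact ⟨k, c, h1, hT.trans h2⟩

theorem count_eq {V : Type*} (m : ℕ) (f : ℕ → V)
    (finj : ∀ i ≤ 2 * m, ∀ j ≤ 2 * m, f i = f j → i = j)
    (fsurj : ∀ v, ∃ i ≤ 2 * m, f i = v) (p : V → Prop) [DecidablePred (fun j => p (f j))] :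
    {v | p v}.ncard = ((Finset.range (2 * m + 1)).filter (fun j => p (f j))).card := by
  classical
  rw [← Finset.card_image_of_injOn (f := f), ← Set.ncard_coe_finset]
  · congr 1
    ext v
    simp only [Set.mem_ofPred_eq, Finset.coe_image, Set.mem_image, Finset.mem_coe,
      Finset.mem_filter, Finset.mem_range]
    constructor
    · intro h
      obtain ⟨i, hi, rfl⟩ := fsurj v
      exact ⟨i, ⟨by omega, h⟩, rfl⟩
    · rintro ⟨i, ⟨_, h⟩, rfl⟩
      exact h
  · intro i hi j hj h
    simp only [Finset.mem_coe, Finset.mem_filter, Finset.mem_range] at hi hj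
    exact finj i (by omega) j (by omega) h

theorem iso_of_fun {V : Type*} (D : Dgr V) (n : ℕ) (E : Dgr (Fin n)) (g : Fin n → V)
    (hg : Function.Bijective g) (h : ∀ i j, D.Arc (g i) (g j) ↔ E.Arc i j) : D.Iso E := by
  refine ⟨(Equiv.ofBijective g hg).symm, ?_⟩
  intro a b
  obtain ⟨i, rfl⟩ := hg.2 a
  obtain ⟨j, rfl⟩ := hg.2 b
  rw [h]
  have : ∀ k, (Equiv.ofBijective g hg).symm (g k) = k := fun k =>
    (Equiv.ofBijective g hg).symm_apply_apply k
  rw [this, this]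

/-- **Claim 2.** Let `D` be a strong digraph of order `n = 2m+1 ≥ 3` containing no cycle
through all of its `T`-vertices, let `C = x_1 ⋯ x_{n-1} x_1` be a cycle of length `n-1`
(here `b i = x_i`), and let `x` be the vertex not on `C`. Then at least two vertices of
`C` are not adjacent to `x`, unless `D` is isomorphic to `D₅` or `D₇` or belongs to
`L₁ ∪ L₂`. -/
theorem statement5 {V : Type*} [Fintype V] (m : ℕ) (D : Dgr V)
    (hcard : Fintype.card V = 2 * m + 1) (hn : 3 ≤ 2 * m + 1)
    (hstrong : D.Strong)
    (hnocyc : ¬ D.CycleThrough {u | D.TVertex m u})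
    (b : ZMod (2 * m) → V) (hb : D.IsCycle b)
    (x : V) (hx : x ∉ Set.range b) :
    (∃ i j : ZMod (2 * m), i ≠ j ∧ ¬ D.Adj x (b i) ∧ ¬ D.Adj x (b j)) ∨
    D.Iso D5 ∨ D.Iso D7 ∨ (∃ E ∈ L1, D.Iso E) ∨ InL2 D m := by
  classical
  have hm : 1 ≤ m := by omega
  have : NeZero (2 * m) := ⟨by omega⟩
  by_cases htwo : ∃ i j : ZMod (2 * m), i ≠ j ∧ ¬ D.Adj x (b i) ∧ ¬ D.Adj x (b j)
  · left; exact htwo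
  right
  push Not at htwo
  obtain ⟨i0, hi0⟩ : ∃ i0 : ZMod (2 * m), ∀ j, j ≠ i0 → D.Adj x (b j) := by
    by_cases h : ∃ i0, ¬ D.Adj x (b i0)
    · obtain ⟨i0, h⟩ := h
      exact ⟨i0, fun j hj => htwo i0 j hj.symm h⟩
    · push Not at h
      exact ⟨0, fun j _ => h j⟩
  obtain ⟨-, binj, barc⟩ := hb
  obtain ⟨f, hf1, hf2⟩ : ∃ f : ℕ → V, (∀ i < 2 * m, f i = b (i0 + (i : ℕ))) ∧ f (2 * m) = x :=
    ⟨fun i => if i < 2 * m then b (i0 + (i : ℕ)) else x, fun i hi => if_pos hi, by simp⟩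
  have castinj : ∀ i < 2 * m, ∀ j < 2 * m, ((i : ℕ) : ZMod (2 * m)) = (j : ℕ) → i = j := by
    intro i hi j hj h
    have := (ZMod.natCast_eq_natCast_iff' i j (2 * m)).1 h
    rwa [Nat.mod_eq_of_lt hi, Nat.mod_eq_of_lt hj] at this
  have finj : ∀ i ≤ 2 * m, ∀ j ≤ 2 * m, f i = f j → i = j := by
    intro i hi j hj h
    by_cases h1 : i < 2 * m <;> by_cases h2 : j < 2 * m
    · rw [hf1 i h1, hf1 j h2] at h
      exact castinj i h1 j h2 (add_left_cancel (binj h))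
    · rw [hf1 i h1, show j = 2 * m by omega, hf2] at h
      exact absurd ⟨_, h⟩ hx
    · rw [hf1 j h2, show i = 2 * m by omega, hf2] at h
      exact absurd ⟨_, h.symm⟩ hx
    · omega
  have gbij : Function.Bijective (fun i : Fin (2 * m + 1) => f i) := by
    rw [Fintype.bijective_iff_injective_and_card]
    refine ⟨?_, by rw [hcard, Fintype.card_fin]⟩
    intro i j h
    exact Fin.ext (finj _ (by have := i.2; omega) _ (by have := j.2; omega) h)
  have fsurj : ∀ v, ∃ i ≤ 2 * m, f i = v := by
    intro v
    obtain ⟨i, hi⟩ := gbij.2 v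
    exact ⟨i, by have := i.2; omega, hi⟩
  have H : Hyp m (fun i j => D.Arc (f i) (f j)) := by
    refine ⟨hm, fun i => D.loopless _, ?_, ?_, ?_, ?_, ?_⟩
    · intro u v S p hvu hS
      refine hnocyc (CycleThrough_mono D
        (cyc_of_path D f (2 * m) finj p hvu (fun j hj => (hS j).1 hj)) ?_)
      intro v _
      obtain ⟨i, hi, rfl⟩ := fsurj v
      exact ⟨i, (hS i).2 hi, rfl⟩
    · intro w u v S hw p hvu hS
      have hT : D.TVertex m (f w) := by
        by_contra hnT
        refine hnocyc (CycleThrough_mono D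
          (cyc_of_path D f (2 * m) finj p hvu (fun j hj => ((hS j).1 hj).1)) ?_)
        intro v hv
        obtain ⟨i, hi, rfl⟩ := fsurj v
        refine ⟨i, (hS i).2 ⟨hi, ?_⟩, rfl⟩
        rintro rfl
        exact hnT hv
      unfold Dgr.TVertex Dgr.outDeg Dgr.inDeg at hT
      rw [count_eq m f finj fsurj (fun v => D.Arc (f w) v),
        count_eq m f finj fsurj (fun v => D.Arc v (f w))] at hT
      unfold outC inC
      convert hT
    · intro i hi
      show D.Arc (f i) (f (i + 1))
      rw [hf1 i (by omega), hf1 (i + 1) hi]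
      have := barc (i0 + (i : ℕ))
      rw [add_assoc] at this
      exact_mod_cast this
    · show D.Arc (f (2 * m - 1)) (f 0)
      rw [hf1 _ (by omega), hf1 0 (by omega)]
      have := barc (i0 + ((2 * m - 1 : ℕ) : ZMod (2 * m)))
      rw [add_assoc] at this
      have h2 : (((2 * m - 1 : ℕ) : ZMod (2 * m)) + 1) = ((0 : ℕ) : ZMod (2 * m)) := by
        have h3 : (((2 * m - 1 + 1 : ℕ)) : ZMod (2 * m)) = ((0 : ℕ) : ZMod (2 * m)) := by
          rw [show 2 * m - 1 + 1 = 2 * m by omega, ZMod.natCast_self, Nat.cast_zero]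
        rw [← h3]
        push_cast
        rfl
      rwa [h2] at this
    · intro i h1 h2
      show D.Arc (f (2 * m)) (f i) ∨ D.Arc (f i) (f (2 * m))
      rw [hf2, hf1 i h2]
      refine hi0 _ ?_
      intro h
      have h3 : ((i : ℕ) : ZMod (2 * m)) = ((0 : ℕ) : ZMod (2 * m)) := by
        rw [Nat.cast_zero]
        exact left_eq_add.1 h.symm
      have := castinj i h2 0 (by omega) h3
      omega
  have B := H.base
  rcases final H B with h | ⟨rfl, h⟩ | ⟨rfl, h⟩
  · right; right; right
    obtain ⟨h1, h2, h3⟩ := h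
    have g0 : b (i0 + 0) = f 0 := by
      rw [hf1 0 (by omega), Nat.cast_zero]
    have img : ∀ s t, t < 2 * m → (fun i : ℕ => b (i0 + (i : ZMod (2 * m)))) '' Set.Icc s t
        = f '' Set.Icc s t := by
      intro s t ht
      refine Set.image_congr ?_
      intro i hi
      simp only [Set.mem_Icc] at hi
      rw [hf1 i (by omega)]
    have setout : ∀ w, ¬ D.Arc w (f 0) → ¬ D.Arc w (f (2 * m)) →
        (∀ i, 1 ≤ i → i < 2 * m → (D.Arc w (f i) ↔ i ≤ m)) →
        {v | D.Arc w v} = f '' Set.Icc 1 m := by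
      intro w q1 q2 q3
      ext v
      obtain ⟨i, hi, rfl⟩ := fsurj v
      simp only [Set.mem_ofPred_eq]
      constructor
      · intro q
        have r1 : i ≠ 0 := by rintro rfl; exact q1 q
        have r2 : i ≠ 2 * m := by rintro rfl; exact q2 q
        have := (q3 i (by omega) (by omega)).1 q
        exact ⟨i, by simp only [Set.mem_Icc]; omega, rfl⟩
      · rintro ⟨j, hj, hji⟩
        simp only [Set.mem_Icc] at hj
        rw [← hji]
        exact (q3 j (by omega) (by omega)).2 (by omega)
    have setin : ∀ w, ¬ D.Arc (f 0) w → ¬ D.Arc (f (2 * m)) w →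
        (∀ i, 1 ≤ i → i < 2 * m → (D.Arc (f i) w ↔ m ≤ i)) →
        {v | D.Arc v w} = f '' Set.Icc m (2 * m - 1) := by
      intro w q1 q2 q3
      ext v
      obtain ⟨i, hi, rfl⟩ := fsurj v
      simp only [Set.mem_ofPred_eq]
      constructor
      · intro q
        have r1 : i ≠ 0 := by rintro rfl; exact q1 q
        have r2 : i ≠ 2 * m := by rintro rfl; exact q2 q
        have := (q3 i (by omega) (by omega)).1 q
        exact ⟨i, by simp only [Set.mem_Icc]; omega, rfl⟩
      · rintro ⟨j, hj, hji⟩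
        simp only [Set.mem_Icc] at hj
        rw [← hji]
        exact (q3 j (by omega) (by omega)).2 (by omega)
    refine ⟨fun i => b (i0 + i), x, hm, fun i j h => add_left_cancel (binj h), ?_, ?_, ?_, ?_, ?_,
      ?_, ?_, ?_⟩
    · rintro ⟨i, hi⟩
      exact hx ⟨_, hi⟩
    · intro i
      have := barc (i0 + i)
      rwa [add_assoc] at this
    · show ¬ D.Adj x (b (i0 + 0))
      rw [g0, ← hf2]
      rintro (q | q)
      · exact B.nX0 q
      · exact B.n0X q
    · rw [img 1 m (by omega), ← hf2]
      exact setout _ B.nX0 (D.loopless _) B.outX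
    · show {v | D.Arc (b (i0 + 0)) v} = _
      rw [img 1 m (by omega), g0]
      exact setout _ (D.loopless _) B.n0X h2
    · rw [img m (2 * m - 1) (by omega), ← hf2]
      exact setin _ B.n0X (D.loopless _) B.inX
    · show {v | D.Arc v (b (i0 + 0))} = _
      rw [img m (2 * m - 1) (by omega), g0]
      exact setin _ (D.loopless _) B.nX0 h1
    · intro i hi j hj
      simp only [Set.mem_Icc] at hi hj
      show ¬ D.Arc (b (i0 + (i : ℕ))) (b (i0 + (j : ℕ)))
      rw [← hf1 i (by omega), ← hf1 j (by omega)]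
      exact h3 i j (by omega) (by omega) (by omega) (by omega)
  · have gb : Function.Bijective (fun i : Fin 5 => f ((i + 1 : Fin 5) : ℕ)) :=
      gbij.comp (Equiv.addRight (1 : Fin 5)).bijective
    by_cases p : D.Arc (f 1) (f 3) <;> by_cases q : D.Arc (f 3) (f 1)
    · right; right; left
      refine ⟨_, Or.inr (Or.inr rfl), iso_of_fun D 5 _ _ gb ?_⟩
      have key : ∀ i j, i ≤ 4 → j ≤ 4 → (D.Arc (f i) (f j) ↔ (i, j) ∈ (1, 3) :: (3, 1) :: tab5) := by
        intro i j hi hj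
        by_cases h1 : (i, j) = (1, 3)
        · rw [h1]
          obtain ⟨rfl, rfl⟩ := Prod.mk.inj h1
          simp [p, tab5]
        · by_cases h2 : (i, j) = (3, 1)
          · rw [h2]
            obtain ⟨rfl, rfl⟩ := Prod.mk.inj h2
            simp [q, tab5]
          · have := h i j hi hj h1 h2
            simpa only [List.mem_cons, h1, h2, false_or] using this
      intro i j
      refine (key _ _ (by have := (i + 1).2; omega) (by have := (j + 1).2; omega)).trans ?_
      show _ ↔ (i, j) ∈ (0, 2) :: (2, 0) :: D5arcs
      revert i j
      decide
    · right; right; left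
      refine ⟨_, Or.inl rfl, iso_of_fun D 5 _ _ gb ?_⟩
      have key : ∀ i j, i ≤ 4 → j ≤ 4 → (D.Arc (f i) (f j) ↔ (i, j) ∈ (1, 3) :: tab5) := by
        intro i j hi hj
        by_cases h1 : (i, j) = (1, 3)
        · rw [h1]
          obtain ⟨rfl, rfl⟩ := Prod.mk.inj h1
          simp [p, tab5]
        · by_cases h2 : (i, j) = (3, 1)
          · rw [h2]
            obtain ⟨rfl, rfl⟩ := Prod.mk.inj h2
            simp [q, tab5]
          · have := h i j hi hj h1 h2
            simpa only [List.mem_cons, h1, h2, false_or] using this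
      intro i j
      refine (key _ _ (by have := (i + 1).2; omega) (by have := (j + 1).2; omega)).trans ?_
      show _ ↔ (i, j) ∈ (0, 2) :: D5arcs
      revert i j
      decide
    · right; right; left
      refine ⟨_, Or.inr (Or.inl rfl), iso_of_fun D 5 _ _ gb ?_⟩
      have key : ∀ i j, i ≤ 4 → j ≤ 4 → (D.Arc (f i) (f j) ↔ (i, j) ∈ (3, 1) :: tab5) := by
        intro i j hi hj
        by_cases h1 : (i, j) = (1, 3)
        · rw [h1]
          obtain ⟨rfl, rfl⟩ := Prod.mk.inj h1
          simp [p, tab5]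
        · by_cases h2 : (i, j) = (3, 1)
          · rw [h2]
            obtain ⟨rfl, rfl⟩ := Prod.mk.inj h2
            simp [q, tab5]
          · have := h i j hi hj h1 h2
            simpa only [List.mem_cons, h1, h2, false_or] using this
      intro i j
      refine (key _ _ (by have := (i + 1).2; omega) (by have := (j + 1).2; omega)).trans ?_
      show _ ↔ (i, j) ∈ (2, 0) :: D5arcs
      revert i j
      decide
    · left
      refine iso_of_fun D 5 _ _ gb ?_
      have key : ∀ i j, i ≤ 4 → j ≤ 4 → (D.Arc (f i) (f j) ↔ (i, j) ∈ tab5) := by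
        intro i j hi hj
        by_cases h1 : (i, j) = (1, 3)
        · rw [h1]
          obtain ⟨rfl, rfl⟩ := Prod.mk.inj h1
          simp [p, tab5]
        · by_cases h2 : (i, j) = (3, 1)
          · rw [h2]
            obtain ⟨rfl, rfl⟩ := Prod.mk.inj h2
            simp [q, tab5]
          · have := h i j hi hj h1 h2
            simpa only [List.mem_cons, h1, h2, false_or] using this
      intro i j
      refine (key _ _ (by have := (i + 1).2; omega) (by have := (j + 1).2; omega)).trans ?_
      show _ ↔ (i, j) ∈ D5arcs
      revert i j
      decide
  · right; left
    have gb : Function.Bijective (fun i : Fin 7 => f ((i + 1 : Fin 7) : ℕ)) :=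
      gbij.comp (Equiv.addRight (1 : Fin 7)).bijective
    refine iso_of_fun D 7 _ _ gb ?_
    intro i j
    refine (h _ _ (by have := (i + 1).2; omega) (by have := (j + 1).2; omega)).trans ?_
    show _ ↔ (i, j) ∈ D7arcs
    revert i j
    decide
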